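/- Let G be the 9 × 9 real symmetric matrix with all diagonal entries equal to 1 and off-diagonal entries (symmetrically extended) G₁₂ = −1, G₁₃ = −√6/2, G₂₄ = −√6/2, G₃₅ = −1/2, G₄₉ = −1/2, G₅₆ = −1/2, G₆₇ = −1/2, G₆₈ = −1/2, G₆₉ = −1/2, and all other off-diagonal entries 0. Then G has exactly 6 positive eigenvalues (with multiplicity), exactly 1 negative eigenvalue, and exactly 2 zero eigenvalues; equivalently G has rank 7 and signature (6,1). -/

import Mathlib

open Real

noncomputable def G11 : Matrix (Fin 9) (Fin 9) ℝ :=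
  !![1, -1, -(Real.sqrt 6 / 2), 0, 0, 0, 0, 0, 0;
     -1, 1, 0, -(Real.sqrt 6 / 2), 0, 0, 0, 0, 0;
     -(Real.sqrt 6 / 2), 0, 1, 0, -(1/2), 0, 0, 0, 0;
     0, -(Real.sqrt 6 / 2), 0, 1, 0, 0, 0, 0, -(1/2);
     0, 0, -(1/2), 0, 1, -(1/2), 0, 0, 0;
     0, 0, 0, 0, -(1/2), 1, -(1/2), -(1/2), -(1/2);
     0, 0, 0, 0, 0, -(1/2), 1, 0, 0;
     0, 0, 0, 0, 0, -(1/2), 0, 1, 0;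
     0, 0, 0, -(1/2), 0, -(1/2), 0, 0, 1]

open Matrix QuadraticMap

section Inertia

variable {n : Type*} [Fintype n] [DecidableEq n]

lemma equivalent_weightedSumSquares_of_diagonal_eq {v w : n → ℝ} {S : Matrix n n ℝ}
    (hS : IsUnit S) (h : diagonal v = Sᵀ * diagonal w * S) :
    (weightedSumSquares ℝ v).Equivalent (weightedSumSquares ℝ w) := by
  have hform (u x : n → ℝ) : weightedSumSquares ℝ u x = x ⬝ᵥ (diagonal u *ᵥ x) := by
    simp only [weightedSumSquares_apply, dotProduct, mulVec_diagonal, smul_eq_mul]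
    exact Finset.sum_congr rfl fun i _ ↦ by ring
  refine ⟨⟨LinearEquiv.ofBijective S.mulVecLin
    ⟨mulVec_injective_iff_isUnit.2 hS, mulVec_surjective_iff_isUnit.2 hS⟩, fun x ↦ ?_⟩⟩
  change weightedSumSquares ℝ w (S *ᵥ x) = _
  rw [hform, hform, h, ← mulVec_mulVec, ← mulVec_mulVec, dotProduct_mulVec x Sᵀ,
    vecMul_transpose]

variable {A R : Matrix n n ℝ} {d : n → ℝ}

lemma equivalent_weightedSumSquares_eigenvalues (hA : A.IsHermitian) (hR : IsUnit R)
    (h : A = Rᵀ * diagonal d * R) :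
    (weightedSumSquares ℝ hA.eigenvalues).Equivalent (weightedSumSquares ℝ d) := by
  let U : Matrix n n ℝ := hA.eigenvectorUnitary
  have hUU : Uᵀ * U = 1 := (Matrix.mem_unitaryGroup_iff').1 hA.eigenvectorUnitary.2
  have hspec : A = U * diagonal hA.eigenvalues * Uᵀ := hA.spectral_theorem
  have hU : IsUnit U := IsUnit.of_mul_eq_one_right _ hUU
  refine equivalent_weightedSumSquares_of_diagonal_eq (hR.mul hU) ?_
  calc diagonal hA.eigenvalues = (Uᵀ * U) * diagonal hA.eigenvalues * (Uᵀ * U) := by simp [hUU]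
    _ = Uᵀ * (U * diagonal hA.eigenvalues * Uᵀ) * U := by simp only [Matrix.mul_assoc]
    _ = Uᵀ * (Rᵀ * diagonal d * R) * U := by rw [← hspec, ← h]
    _ = (R * U)ᵀ * diagonal d * (R * U) := by simp only [transpose_mul, Matrix.mul_assoc]

/-- Sylvester's law of inertia for the positive eigenvalues of a real symmetric matrix. -/
lemma card_eigenvalues_pos_eq (hA : A.IsHermitian) (hR : IsUnit R)
    (h : A = Rᵀ * diagonal d * R) :
    (Finset.univ.filter fun j ↦ 0 < hA.eigenvalues j).card =
      (Finset.univ.filter fun j ↦ 0 < d j).card := by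
  have := (equivalent_weightedSumSquares_eigenvalues hA hR h).sigPos_eq
  simpa [QuadraticForm.sigPos_weightedSumSquares, Set.ncard_eq_toFinset_card'] using this

/-- Sylvester's law of inertia for the negative eigenvalues of a real symmetric matrix. -/
lemma card_eigenvalues_neg_eq (hA : A.IsHermitian) (hR : IsUnit R)
    (h : A = Rᵀ * diagonal d * R) :
    (Finset.univ.filter fun j ↦ hA.eigenvalues j < 0).card =
      (Finset.univ.filter fun j ↦ d j < 0).card := by
  have := (equivalent_weightedSumSquares_eigenvalues hA hR h).sigNeg_eq
  simpa [QuadraticForm.sigNeg_weightedSumSquares, Set.ncard_eq_toFinset_card'] using this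

lemma card_pos_add_card_neg (v : n → ℝ) :
    (Finset.univ.filter fun j ↦ 0 < v j).card + (Finset.univ.filter fun j ↦ v j < 0).card =
      (Finset.univ.filter fun j ↦ v j ≠ 0).card := by
  rw [← Finset.card_union_of_disjoint]
  · congr 1
    ext j
    simp only [Finset.mem_union, Finset.mem_filter_univ]
    exact lt_or_lt_iff_ne.trans ne_comm
  · exact Finset.disjoint_filter.2 fun j _ h ↦ h.le.not_gt

end Inertia

/-- Completing squares in the quadratic form of `G11`: the pivots. -/
noncomputable def pivotsG11 : Fin 9 → ℝ := ![-2, 0, 1, 1, 1/4, 1/2, 1, 1, 0]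

/-- Completing squares in the quadratic form of `G11`: the linear forms being squared. -/
noncomputable def formsG11 : Matrix (Fin 9) (Fin 9) ℝ :=
  !![1, 1/2, 0, 0, 0, 0, 0, 0, √6 / 4;
     0, 1, 0, 0, 0, 0, 0, 0, 0;
     -(√6 / 2), 0, 1, 0, -(1/2), 0, 0, 0, 0;
     0, -(√6 / 2), 0, 1, 0, 0, 0, 0, -(1/2);
     -√6, 0, 0, 0, 1, 0, 0, 0, -2;
     0, 0, 0, 0, -1, 1, 0, 0, -1;
     0, 0, 0, 0, 0, -(1/2), 1, 0, 0;
     0, 0, 0, 0, 0, -(1/2), 0, 1, 0;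
     0, 0, 0, 0, 0, 0, 0, 0, 1]

lemma isUnit_formsG11 : IsUnit formsG11 := by
  rw [← mulVec_injective_iff_isUnit]
  refine (injective_iff_map_eq_zero formsG11.mulVecLin).2 fun x hx ↦ ?_
  have e (i : Fin 9) : (formsG11 *ᵥ x) i = 0 := congrFun hx i
  have h0 := e 0
  have h1 := e 1
  have h2 := e 2
  have h3 := e 3
  have h4 := e 4
  have h5 := e 5
  have h6 := e 6
  have h7 := e 7
  have h8 := e 8
  clear e hx
  simp [formsG11, mulVec, dotProduct, Fin.sum_univ_succ] at h0 h1 h2 h3 h4 h5 h6 h7 h8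
  have x0 : x 0 = 0 := by simpa [h1, h8] using h0
  have x4 : x 4 = 0 := by simpa [x0, h8] using h4
  have x5 : x 5 = 0 := by simpa [x4, h8] using h5
  ext i
  fin_cases i <;> simp_all

lemma G11_eq_congr_diagonal : G11 = formsG11ᵀ * diagonal pivotsG11 * formsG11 := by
  have h6 : √6 * √6 = 6 := Real.mul_self_sqrt (by norm_num)
  ext i j
  rw [mul_apply]
  simp only [mul_diagonal, transpose_apply]
  fin_cases i <;> fin_cases j <;>
    simp [G11, formsG11, pivotsG11, Fin.sum_univ_succ] <;> grind

theorem stmt_11 (hG : G11.IsHermitian) :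
    (Finset.univ.filter fun j => 0 < hG.eigenvalues j).card = 6 ∧
    (Finset.univ.filter fun j => hG.eigenvalues j < 0).card = 1 ∧
    (Finset.univ.filter fun j => hG.eigenvalues j = 0).card = 2 ∧
    G11.rank = 7 := by
  have hpos : (Finset.univ.filter fun j ↦ 0 < hG.eigenvalues j).card = 6 := by
    rw [card_eigenvalues_pos_eq hG isUnit_formsG11 G11_eq_congr_diagonal, Finset.card_filter]
    simp [-Finset.sum_boole, pivotsG11, Fin.sum_univ_succ]
  have hneg : (Finset.univ.filter fun j ↦ hG.eigenvalues j < 0).card = 1 := by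
    rw [card_eigenvalues_neg_eq hG isUnit_formsG11 G11_eq_congr_diagonal, Finset.card_filter]
    norm_num [-Finset.sum_boole, pivotsG11, Fin.sum_univ_succ]
  have hne := card_pos_add_card_neg hG.eigenvalues
  have htot := Finset.card_filter_add_card_filter_not (s := Finset.univ)
    fun j ↦ hG.eigenvalues j = 0
  rw [Finset.card_univ, Fintype.card_fin] at htot
  refine ⟨hpos, hneg, by lia, ?_⟩
  rw [hG.rank_eq_card_non_zero_eigs, Fintype.card_subtype]
  lia
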